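/- Let σ be a field automorphism of F_q with σ ≠ id and let s be the order of the fixed subfield of σ. The minimum distance of the code C(Λ_σ), i.e. the minimum of wt(c_M) over all nonzero (n+1)×(n+1) matrices M over F_q, equals q³ − s³ if n = 2 and σ² = id (so q = s²), and equals q^{2n−1} − q^{n−1} if n > 2 or σ² ≠ id. -/

import Mathlib

open Matrix

/-- `wt σ M` : the Hamming weight of the codeword `c_M` of `C(Λ_σ)`, i.e. the number of
pairs of projective points `([x],[ξ])` with `ξ·x = 0` and `ξ·M·x^σ ≠ 0`. -/
noncomputable def wt {F : Type} [Field F] [Fintype F] {n : ℕ}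
    (σ : F ≃+* F) (M : Matrix (Fin (n + 1)) (Fin (n + 1)) F) : ℕ :=
  Nat.card {pq : Projectivization F (Fin (n + 1) → F) × Projectivization F (Fin (n + 1) → F) //
    pq.2.rep ⬝ᵥ pq.1.rep = 0 ∧ (pq.2.rep ᵥ* M) ⬝ᵥ (fun i => σ (pq.1.rep i)) ≠ 0}

theorem card_forall_dotProduct_eq_zero {F : Type*} [Field F] {m k : ℕ}
    {v : Fin k → Fin m → F} (hv : LinearIndependent F v) :
    Nat.card {ξ : Fin m → F // ∀ i, ξ ⬝ᵥ v i = 0} * Nat.card F ^ k = Nat.card F ^ m := by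
  have hr : (Matrix.of v).rank = k := by
    simpa using LinearIndependent.rank_matrix (M := Matrix.of v) hv
  have h := LinearMap.finrank_range_add_finrank_ker (Matrix.of v).mulVecLin
  rw [← Matrix.rank, hr, Module.finrank_fin_fun] at h
  have hc : Nat.card {ξ : Fin m → F // ∀ i, ξ ⬝ᵥ v i = 0} =
      Nat.card (LinearMap.ker (Matrix.of v).mulVecLin) := by
    refine Nat.card_congr (Equiv.subtypeEquivRight fun ξ => ?_)
    simp [funext_iff, Matrix.mulVec, dotProduct_comm ξ]
  rw [hc, Module.natCard_eq_pow_finrank (K := F), ← pow_add, add_comm, h]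

theorem card_ne_zero_and_eq_card_projectivization_mul {F V : Type*} [Field F] [AddCommGroup V]
    [Module F V] (Q : V → Prop) (hQ : ∀ (c : F) (v : V), c ≠ 0 → (Q (c • v) ↔ Q v)) :
    Nat.card {v : V // v ≠ 0 ∧ Q v} =
      Nat.card {p : Projectivization F V // Q p.rep} * Nat.card Fˣ := by
  rw [← Nat.card_prod]
  symm
  refine Nat.card_congr (Equiv.ofBijective (fun pc => ⟨(pc.2 : F) • pc.1.1.rep,
    smul_ne_zero pc.2.ne_zero pc.1.1.rep_nonzero, (hQ _ _ pc.2.ne_zero).2 pc.1.2⟩) ⟨?_, ?_⟩)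
  · rintro ⟨⟨p, hp⟩, c⟩ ⟨⟨p', hp'⟩, c'⟩ h
    have h : (c : F) • p.rep = (c' : F) • p'.rep := congrArg Subtype.val h
    obtain rfl : p = p' := by
      rw [← p.mk_rep, ← p'.mk_rep, Projectivization.mk_eq_mk_iff]
      refine ⟨c⁻¹ * c', ?_⟩
      rw [mul_smul, inv_smul_eq_iff]
      exact h.symm
    have := smul_left_injective F p.rep_nonzero h
    simp [Units.ext_iff, this]
  · rintro ⟨v, hv, hQv⟩
    obtain ⟨a, ha⟩ := Projectivization.exists_smul_eq_mk_rep F v hv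
    have ha' : (a : F) • v = (Projectivization.mk F v hv).rep := ha
    refine ⟨⟨⟨Projectivization.mk F v hv, ?_⟩, a⁻¹⟩, ?_⟩
    · rw [← ha', hQ _ _ a.ne_zero]
      exact hQv
    · simp [← ha']

theorem card_hyperplanes_through_avoiding {F : Type*} [Field F] [Finite F] {n : ℕ} (hn : 1 ≤ n)
    {x y : Fin (n + 1) → F} (h : LinearIndependent F ![x, y]) :
    Nat.card {p : Projectivization F (Fin (n + 1) → F) // p.rep ⬝ᵥ x = 0 ∧ p.rep ⬝ᵥ y ≠ 0} =
      Nat.card F ^ (n - 1) := by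
  have hx : x ≠ 0 := by simpa using h.ne_zero 0
  have h1 := card_forall_dotProduct_eq_zero
    (v := ![x]) (by simpa [linearIndependent_unique_iff] using hx)
  have h2 := card_forall_dotProduct_eq_zero h
  have h3 := card_ne_zero_and_eq_card_projectivization_mul (F := F) (V := Fin (n + 1) → F)
    (fun ξ => ξ ⬝ᵥ x = 0 ∧ ξ ⬝ᵥ y ≠ 0) (by intro c v hc; simp [hc])
  have h4 : Nat.card {ξ : Fin (n + 1) → F // ∀ i, ξ ⬝ᵥ ![x] i = 0} =
      Nat.card {ξ : Fin (n + 1) → F // ∀ i, ξ ⬝ᵥ ![x, y] i = 0} +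
      Nat.card {ξ : Fin (n + 1) → F // ξ ≠ 0 ∧ (ξ ⬝ᵥ x = 0 ∧ ξ ⬝ᵥ y ≠ 0)} := by
    have e1 : {ξ : Fin (n + 1) → F | ∀ i, ξ ⬝ᵥ ![x] i = 0} =
      {ξ | ∀ i, ξ ⬝ᵥ ![x, y] i = 0} ∪ {ξ | ξ ≠ 0 ∧ (ξ ⬝ᵥ x = 0 ∧ ξ ⬝ᵥ y ≠ 0)} := by
      ext ξ
      by_cases h0 : ξ = 0
      · simp [h0]
      · simp [Fin.forall_fin_two, h0]
        tauto
    have e2 : Disjoint {ξ : Fin (n + 1) → F | ∀ i, ξ ⬝ᵥ ![x, y] i = 0}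
        {ξ | ξ ≠ 0 ∧ (ξ ⬝ᵥ x = 0 ∧ ξ ⬝ᵥ y ≠ 0)} := by
      rw [Set.disjoint_left]
      intro ξ hξ hξ'
      exact hξ'.2.2 (hξ 1)
    have := Set.ncard_union_eq e2
    rw [← e1] at this
    exact this
  rw [h3] at h4
  have hq : 2 ≤ Nat.card F := Finite.one_lt_card
  obtain ⟨m, rfl⟩ : ∃ m, n = m + 1 := ⟨n - 1, by omega⟩
  rw [Nat.card_units] at h4
  obtain ⟨r, hr⟩ : ∃ r, Nat.card F = r + 1 := ⟨Nat.card F - 1, by omega⟩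
  rw [hr] at h1 h2 h4 ⊢
  have hr0 : 0 < r := by
    rw [hr] at hq
    omega
  simp only [Nat.add_sub_cancel] at h4 ⊢
  have k1 := Nat.eq_of_mul_eq_mul_right (by positivity)
    (h1.trans (pow_add (r + 1) (m + 1) 1))
  have k2 := Nat.eq_of_mul_eq_mul_right (by positivity) (h2.trans (pow_add (r + 1) m 2))
  rw [k1, k2] at h4
  refine Nat.eq_of_mul_eq_mul_right hr0 ?_
  rw [pow_succ] at h4
  linarith

theorem wt_mul_card_units {F : Type} [Field F] [Fintype F] {n : ℕ} (hn : 1 ≤ n)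
    (σ : F ≃+* F) (M : Matrix (Fin (n + 1)) (Fin (n + 1)) F) :
    wt σ M * Nat.card Fˣ = Nat.card F ^ (n - 1) *
      Nat.card {x : Fin (n + 1) → F //
        x ≠ 0 ∧ LinearIndependent F ![x, M *ᵥ fun i => σ (x i)]} := by
  classical
  have h := card_ne_zero_and_eq_card_projectivization_mul (F := F) (V := Fin (n + 1) → F)
    (fun x => LinearIndependent F ![x, M *ᵥ fun i => σ (x i)]) (by
      intro c v hc
      have hc' : σ c ≠ 0 := by simpa using hc
      have : (M *ᵥ fun i => σ ((c • v) i)) = σ c • (M *ᵥ fun i => σ (v i)) := by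
        rw [← Matrix.mulVec_smul]
        congr 1
        ext i
        simp
      simp only [this]
      convert! LinearIndependent.units_smul_iff (v := ![v, M *ᵥ fun i => σ (v i)])
        (w := ![Units.mk0 c hc, Units.mk0 _ hc']) using 2
      ext i j
      fin_cases i <;> simp [Units.smul_def])
  rw [h, ← mul_assoc]
  congr 1
  let e : {pq : Projectivization F (Fin (n + 1) → F) × Projectivization F (Fin (n + 1) → F) //
      pq.2.rep ⬝ᵥ pq.1.rep = 0 ∧ (pq.2.rep ᵥ* M) ⬝ᵥ (fun i => σ (pq.1.rep i)) ≠ 0} ≃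
      Σ x : {p : Projectivization F (Fin (n + 1) → F) //
        LinearIndependent F ![p.rep, M *ᵥ fun i => σ (p.rep i)]},
      {p : Projectivization F (Fin (n + 1) → F) //
        p.rep ⬝ᵥ x.1.rep = 0 ∧ p.rep ⬝ᵥ (M *ᵥ fun i => σ (x.1.rep i)) ≠ 0} :=
    { toFun := fun pq => ⟨⟨pq.1.1, by
          rw [LinearIndependent.pair_iff' pq.1.1.rep_nonzero]
          intro a ha
          apply pq.2.2
          rw [← dotProduct_mulVec, ← ha, dotProduct_smul, pq.2.1, smul_zero]⟩,
        ⟨pq.1.2, pq.2.1, by rw [dotProduct_mulVec]; exact pq.2.2⟩⟩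
      invFun := fun z => ⟨(z.1.1, z.2.1), z.2.2.1, by
        rw [← dotProduct_mulVec]; exact z.2.2.2⟩
      left_inv := fun _ => rfl
      right_inv := fun _ => rfl }
  have : Fintype {p : Projectivization F (Fin (n + 1) → F) //
        LinearIndependent F ![p.rep, M *ᵥ fun i => σ (p.rep i)]} := Fintype.ofFinite _
  rw [wt, Nat.card_congr e, Nat.card_sigma,
    Finset.sum_congr rfl fun x _ => card_hyperplanes_through_avoiding hn x.2]
  simp [mul_comm]

theorem card_semilinear_solutions_le {F : Type*} [Field F] [Finite F] (σ : F ≃+* F) {a : F}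
    (ha : a ≠ 0) (b : F) :
    Nat.card {c : F // σ c * a = b * c} ≤ Nat.card {c : F // σ c = c} := by
  by_cases h : ∃ d, d ≠ 0 ∧ σ d * a = b * d
  · obtain ⟨d, hd, hd'⟩ := h
    have hσd : σ d ≠ 0 := by simpa using hd
    refine Nat.card_le_card_of_injective (fun c => ⟨c.1 / d, ?_⟩) ?_
    · rw [map_div₀, div_eq_div_iff hσd hd]
      apply mul_right_cancel₀ ha
      linear_combination d * c.2 - c.1 * hd'
    · intro c c' hcc
      have h : c.1 / d = c'.1 / d := congrArg Subtype.val hcc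
      exact Subtype.ext ((div_left_inj' hd).1 h)
  · push Not at h
    refine Nat.card_le_card_of_injective (fun _ => ⟨0, map_zero σ⟩) ?_
    intro c c' _
    apply Subtype.ext
    rw [not_imp_comm.1 (h c.1) (not_not.2 c.2), not_imp_comm.1 (h c'.1) (not_not.2 c'.2)]

theorem card_diagonal_eigenvectors_le {F : Type*} [Field F] [Finite F] (σ : F ≃+* F) (d : ℕ)
    (a : Fin d → F) (ha : ∀ i, a i ≠ 0) :
    Nat.card {c : Fin d → F // c ≠ 0 ∧ ∃ b, ∀ i, σ (c i) * a i = b * c i} ≤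
      Nat.card Fˣ * ∑ i ∈ Finset.range d, Nat.card {c : F // σ c = c} ^ i := by
  classical
  have : Fintype Fˣ := Fintype.ofFinite _
  induction d with
  | zero =>
    have : IsEmpty {c : Fin 0 → F // c ≠ 0 ∧ ∃ b, ∀ i, σ (c i) * a i = b * c i} :=
      ⟨fun c => c.2.1 (Subsingleton.elim _ _)⟩
    simp
  | succ d ih =>
    have ih := ih (fun i => a i.succ) (fun i => ha i.succ)
    let f : {c : Fin (d + 1) → F // c ≠ 0 ∧ ∃ b, ∀ i, σ (c i) * a i = b * c i} →
        {c : Fin d → F // c ≠ 0 ∧ ∃ b, ∀ i, σ (c i) * a i.succ = b * c i} ⊕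
        Σ u : Fˣ, ∀ i : Fin d, {c : F // σ c * a i.succ = (σ u * a 0 / u) * c} := fun c =>
      if h : c.1 0 = 0 then Sum.inl ⟨fun i => c.1 i.succ, by
          intro h'
          apply c.2.1
          ext i
          exact Fin.cases h (fun j => congrFun h' j) i, by
          obtain ⟨b, hb⟩ := c.2.2
          exact ⟨b, fun i => hb i.succ⟩⟩
      else Sum.inr ⟨Units.mk0 _ h, fun i => ⟨c.1 i.succ, by
          obtain ⟨b, hb⟩ := c.2.2
          rw [hb, Units.val_mk0, hb 0, mul_div_cancel_right₀ _ h]⟩⟩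
    have hf : Function.Injective f := by
      rintro ⟨c, hc⟩ ⟨c', hc'⟩ hcc
      apply Subtype.ext
      ext i
      by_cases h : c 0 = 0 <;> by_cases h' : c' 0 = 0 <;>
        simp only [f, h, h', dite_true, dite_false, reduceCtorEq, Sum.inl.injEq, Sum.inr.injEq,
          Subtype.mk.injEq] at hcc
      · exact Fin.cases (h.trans h'.symm) (fun j => congrFun hcc j) i
      · have h0 : c 0 = c' 0 := congrArg (fun z => (z.1 : F)) hcc
        exact Fin.cases h0 (fun j => congrArg (fun z => (z.2 j : F)) hcc) i
    refine (Nat.card_le_card_of_injective f hf).trans ?_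
    rw [Nat.card_sum, Nat.card_sigma, Finset.sum_range_succ, mul_add]
    refine add_le_add ih ?_
    refine (Finset.sum_le_card_nsmul _ _ (Nat.card {c : F // σ c = c} ^ d) fun u _ => ?_).trans ?_
    · rw [Nat.card_pi]
      refine (Finset.prod_le_pow_card _ _ _ fun i _ =>
        card_semilinear_solutions_le σ (ha i.succ) _).trans ?_
      simp
    · simp

theorem card_eigenvectors_le {F : Type*} [Field F] [Finite F] (σ : F ≃+* F) {m : ℕ}
    (M : Matrix (Fin m) (Fin m) F) :
    Nat.card {x : Fin m → F // x ≠ 0 ∧ ∃ b : F, b ≠ 0 ∧ b • x = M *ᵥ fun i => σ (x i)} ≤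
      Nat.card Fˣ * ∑ i ∈ Finset.range M.rank, Nat.card {c : F // σ c = c} ^ i := by
  classical
  obtain ⟨d, v, hvS, hspan, hli⟩ : ∃ (d : ℕ) (v : Fin d → Fin m → F),
      (∀ i, v i ≠ 0 ∧ ∃ b : F, b ≠ 0 ∧ b • v i = M *ᵥ fun j => σ (v i j)) ∧
      Submodule.span F (Set.range v) = Submodule.span F
        {x | x ≠ 0 ∧ ∃ b : F, b ≠ 0 ∧ b • x = M *ᵥ fun i => σ (x i)} ∧
      LinearIndependent F v :=
    ⟨_, Submodule.exists_fun_fin_finrank_span_eq F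
      {x | x ≠ 0 ∧ ∃ b : F, b ≠ 0 ∧ b • x = M *ᵥ fun i => σ (x i)}⟩
  choose hv0 a ha hav using hvS
  have hd : d ≤ M.rank := by
    have hmem : ∀ i, v i ∈ LinearMap.range M.mulVecLin := fun i =>
      ⟨(a i)⁻¹ • fun j => σ (v i j), by
        rw [map_smul, Matrix.mulVecLin_apply, ← hav, inv_smul_smul₀ (ha i)]⟩
    have h1 : LinearIndependent F fun i => (⟨v i, hmem i⟩ : LinearMap.range M.mulVecLin) :=
      LinearIndependent.of_comp (LinearMap.range M.mulVecLin).subtype hli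
    simpa [Matrix.rank] using h1.fintype_card_le_finrank
  have hc : ∀ x : {x : Fin m → F // x ≠ 0 ∧ ∃ b : F, b ≠ 0 ∧ b • x = M *ᵥ fun i => σ (x i)},
      ∃ c : Fin d → F, ∑ i, c i • v i = x.1 := by
    intro x
    rw [← Submodule.mem_span_range_iff_exists_fun, hspan]
    exact Submodule.subset_span x.2
  choose c hc using hc
  refine (Nat.card_le_card_of_injective (β := {c : Fin d → F // c ≠ 0 ∧
    ∃ b, ∀ i, σ (c i) * a i = b * c i}) (fun x => ⟨c x, ?_, ?_⟩) ?_).trans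
    ((card_diagonal_eigenvectors_le σ d a ha).trans ?_)
  · intro h
    apply x.2.1
    rw [← hc x, h]
    simp
  · obtain ⟨b, -, hb⟩ := x.2.2
    refine ⟨b, fun i => ?_⟩
    have e : (fun j => σ (x.1 j)) = ∑ i, σ (c x i) • fun j => σ (v i j) := by
      ext j
      rw [← hc x]
      simp
    rw [e, Matrix.mulVec_sum, ← hc x, Finset.smul_sum] at hb
    simp only [Matrix.mulVec_smul, ← hav, smul_smul] at hb
    rw [← sub_eq_zero, ← Finset.sum_sub_distrib] at hb
    simp only [← sub_smul] at hb
    exact (sub_eq_zero.1 (Fintype.linearIndependent_iff.1 hli _ hb i)).symm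
  · intro x y hxy
    have h : c x = c y := congrArg Subtype.val hxy
    apply Subtype.ext
    rw [← hc x, ← hc y, h]
  · gcongr

theorem card_mulVec_comp_eq_zero {F : Type*} [Field F] [Finite F] (σ : F ≃+* F) {m : ℕ}
    (M : Matrix (Fin m) (Fin m) F) :
    Nat.card {x : Fin m → F // (M *ᵥ fun i => σ (x i)) = 0} = Nat.card F ^ (m - M.rank) := by
  have h := LinearMap.finrank_range_add_finrank_ker M.mulVecLin
  rw [← Matrix.rank, Module.finrank_fin_fun] at h
  rw [show m - M.rank = _ from Nat.sub_eq_of_eq_add' h.symm, ← Module.natCard_eq_pow_finrank]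
  exact Nat.card_congr ((Equiv.piCongrRight fun _ => σ.toEquiv).subtypeEquiv fun x => by
    simp [funext_iff]
    rfl)

theorem le_card_linearIndependent_add {F : Type*} [Field F] [Finite F] (σ : F ≃+* F) {m : ℕ}
    (M : Matrix (Fin m) (Fin m) F) :
    Nat.card F ^ m ≤ Nat.card {x : Fin m → F //
        x ≠ 0 ∧ LinearIndependent F ![x, M *ᵥ fun i => σ (x i)]} +
      (Nat.card F ^ (m - M.rank) +
      Nat.card Fˣ * ∑ i ∈ Finset.range M.rank, Nat.card {c : F // σ c = c} ^ i) := by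
  have hU : (Set.univ : Set (Fin m → F)) ⊆
      {x | x ≠ 0 ∧ LinearIndependent F ![x, M *ᵥ fun i => σ (x i)]} ∪
      ({x | (M *ᵥ fun i => σ (x i)) = 0} ∪
      {x | x ≠ 0 ∧ ∃ b : F, b ≠ 0 ∧ b • x = M *ᵥ fun i => σ (x i)}) := by
    intro x _
    by_cases hx : x = 0
    · right
      left
      simp only [hx, Set.mem_ofPred_eq, Pi.zero_apply, map_zero]
      exact Matrix.mulVec_zero M
    · by_cases hl : LinearIndependent F ![x, M *ᵥ fun i => σ (x i)]
      · exact Or.inl ⟨hx, hl⟩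
      · right
        rw [LinearIndependent.pair_iff' hx] at hl
        push Not at hl
        obtain ⟨b, hb⟩ := hl
        by_cases hb0 : b = 0
        · left
          simp [← hb, hb0]
        · exact Or.inr ⟨hx, b, hb0, hb⟩
  have h := Set.ncard_le_ncard hU (Set.toFinite _)
  rw [Set.ncard_univ, Nat.card_fun, Nat.card_fin] at h
  refine h.trans ((Set.ncard_union_le _ _).trans
    (add_le_add le_rfl ((Set.ncard_union_le _ _).trans (add_le_add ?_ ?_))))
  · exact (card_mulVec_comp_eq_zero σ M).le
  · exact card_eigenvectors_le σ M

theorem pow_add_eq_add_mul_sum (p a m : ℕ) :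
    (p + 1) ^ (a + m) = (p + 1) ^ a + p * ∑ i ∈ Finset.range m, (p + 1) ^ (a + i) := by
  induction m with
  | zero => simp
  | succ m ih =>
    rw [Finset.sum_range_succ, mul_add, ← add_assoc (_ ^ a), ← ih]
    ring

theorem sum_pow_succ_le_sum_pow {s q n : ℕ} (hs : 2 ≤ s) (hq : s ^ 2 ≤ q) (hn : 2 ≤ n)
    (h : 2 < n ∨ s ^ 3 ≤ q) :
    ∑ i ∈ Finset.range n, s ^ (i + 1) ≤ ∑ i ∈ Finset.range n, q ^ i := by
  have hpow : ∀ i, s ^ (2 * i) ≤ q ^ i := fun i => by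
    rw [pow_mul]
    gcongr
  obtain ⟨k, rfl⟩ : ∃ k, n = k + 2 := ⟨n - 2, by omega⟩
  rw [Finset.sum_range_succ', Finset.sum_range_succ, Finset.sum_range_succ' _ (k + 1),
    Finset.sum_range_succ _ k]
  have h1 : ∑ i ∈ Finset.range k, s ^ (i + 1 + 1) ≤ ∑ i ∈ Finset.range k, q ^ (i + 1) :=
    Finset.sum_le_sum fun i _ => le_trans (Nat.pow_le_pow_right (by omega) (by omega)) (hpow _)
  have h2 : s ^ (k + 1 + 1) + s ≤ q ^ (k + 1) := by
    have h3 : s ^ (k + 3) ≤ q ^ (k + 1) := by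
      rcases h with h | h
      · exact (Nat.pow_le_pow_right (by omega) (by omega)).trans (hpow _)
      · calc s ^ (k + 3) ≤ s ^ (3 * (k + 1)) := Nat.pow_le_pow_right (by omega) (by omega)
          _ = (s ^ 3) ^ (k + 1) := pow_mul _ _ _
          _ ≤ _ := by gcongr
    have h4 : s ≤ s ^ (k + 2) := Nat.le_self_pow (by omega) s
    have h5 : s ^ (k + 3) = s * s ^ (k + 2) := by ring
    have : 2 * s ^ (k + 2) ≤ s * s ^ (k + 2) := by gcongr
    change s ^ (k + 2) + s ≤ _
    omega
  simp only [zero_add, pow_one, pow_zero]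
  omega

theorem pow_add_mul_geom_sum_le {s p n r : ℕ} (hs : 2 ≤ s) (hq : s ^ 2 ≤ p + 1) (hn : 2 ≤ n)
    (h : 2 < n ∨ s ^ 3 ≤ p + 1) (hr : 1 ≤ r) (hr' : r ≤ n + 1) :
    (p + 1) ^ (n + 1 - r) + p * ∑ i ∈ Finset.range r, s ^ i ≤ (p + 1) ^ n + p := by
  obtain ⟨m, rfl⟩ : ∃ m, r = m + 1 := ⟨r - 1, by omega⟩
  obtain ⟨a, rfl⟩ : ∃ a, n = a + m := ⟨n - m, by omega⟩
  rw [pow_add_eq_add_mul_sum, Finset.sum_range_succ', show a + m + 1 - (m + 1) = a by omega,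
    pow_zero, mul_add, mul_one, ← add_assoc]
  gcongr _ + p * ?_ + _
  rcases Nat.eq_zero_or_pos a with rfl | ha
  · simp only [zero_add] at *
    exact sum_pow_succ_le_sum_pow hs hq hn h
  · refine Finset.sum_le_sum fun i _ => ?_
    calc s ^ (i + 1) ≤ (s ^ 2) ^ (i + 1) := by
          gcongr
          exact Nat.le_self_pow (by omega) s
      _ ≤ (p + 1) ^ (i + 1) := by gcongr
      _ ≤ _ := Nat.pow_le_pow_right (by omega) (by omega)

theorem two_le_card_fixed {F : Type*} [Field F] [Finite F] (σ : F ≃+* F) :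
    2 ≤ Nat.card {c : F // σ c = c} := by
  rw [← Nat.card_fin 2]
  refine Nat.card_le_card_of_injective (fun i => if i = 0 then ⟨0, map_zero σ⟩
    else ⟨1, map_one σ⟩) ?_
  intro i j
  fin_cases i <;> fin_cases j <;> simp

theorem exists_card_eq_card_fixed_pow {F : Type*} [Field F] [Finite F] (σ : F ≃+* F)
    (hσ : σ ≠ RingEquiv.refl F) :
    ∃ m, 2 ≤ m ∧ Nat.card F = Nat.card {c : F // σ c = c} ^ m ∧
      (σ.trans σ ≠ RingEquiv.refl F → 3 ≤ m) := by
  let K : Subfield F := (σ : F →+* F).eqLocusField (RingHom.id F)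
  let τ : F ≃ₐ[K] F := AlgEquiv.ofRingEquiv (f := σ) fun x => x.2
  have hτ : τ ≠ 1 := fun h => hσ (RingEquiv.ext fun x => congrArg (fun g => g x) h)
  have hle := AlgEquiv.card_le (F := K) (K := F)
  have hpos : 1 < Fintype.card (F ≃ₐ[K] F) := Fintype.one_lt_card_iff.2 ⟨τ, 1, hτ⟩
  refine ⟨Module.finrank K F, by omega, Module.natCard_eq_pow_finrank (K := K), fun h2 => ?_⟩
  by_contra! hlt
  have hcard : Fintype.card (F ≃ₐ[K] F) = 2 := by omega
  have h3 : τ ^ 2 = 1 := hcard ▸ pow_card_eq_one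
  exact h2 (RingEquiv.ext fun x => congrArg (fun g => g x) h3)

theorem card_eq_card_fixed_sq {F : Type*} [Field F] [Finite F] (σ : F ≃+* F)
    (hσ : σ ≠ RingEquiv.refl F) (hσ2 : σ.trans σ = RingEquiv.refl F) :
    Nat.card F = Nat.card {c : F // σ c = c} ^ 2 := by
  have hinv : ∀ x, σ (σ x) = x := fun x => congrArg (fun g => g x) hσ2
  obtain ⟨a, ha⟩ : ∃ a, σ a ≠ a := by
    by_contra! h
    exact hσ (RingEquiv.ext h)
  have ha' : a - σ a ≠ 0 := sub_ne_zero.2 ha.symm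
  rw [sq, ← Nat.card_prod]
  symm
  refine Nat.card_congr (Equiv.ofBijective (fun u => u.1.1 + u.2.1 * a) ⟨?_, ?_⟩)
  · rintro ⟨⟨u, hu⟩, ⟨v, hv⟩⟩ ⟨⟨u', hu'⟩, ⟨v', hv'⟩⟩ h
    simp only at h
    have h' := congrArg σ h
    simp only [map_add, map_mul, hu, hv, hu', hv'] at h'
    have hvv : v = v' := mul_right_cancel₀ ha' (by linear_combination h - h')
    subst hvv
    simpa using h
  · intro x
    have hv : σ ((x - σ x) / (a - σ a)) = (x - σ x) / (a - σ a) := by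
      rw [map_div₀, map_sub, map_sub, hinv, hinv, ← neg_sub x, ← neg_sub a, neg_div_neg_eq]
    refine ⟨⟨⟨x - (x - σ x) / (a - σ a) * a, ?_⟩, ⟨_, hv⟩⟩, ?_⟩
    · rw [map_sub, map_mul, hv]
      field_simp
      ring
    · simp

theorem one_le_rank_of_ne_zero {F : Type*} [Field F] {m : ℕ} {M : Matrix (Fin m) (Fin m) F}
    (hM : M ≠ 0) : 1 ≤ M.rank := by
  rw [Nat.one_le_iff_ne_zero]
  intro h
  rw [Matrix.rank, Submodule.finrank_eq_zero, LinearMap.range_eq_bot] at h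
  exact hM (Matrix.toLin'.injective (by simpa [Matrix.toLin'_apply'] using h))

theorem le_wt_of_eigenvector_bound {F : Type} [Field F] [Fintype F] {n : ℕ} (hn : 1 ≤ n)
    (σ : F ≃+* F) (M : Matrix (Fin (n + 1)) (Fin (n + 1)) F) {g : ℕ}
    (h : Nat.card F ^ (n + 1 - M.rank) +
      Nat.card Fˣ * ∑ i ∈ Finset.range M.rank, Nat.card {c : F // σ c = c} ^ i +
      Nat.card Fˣ * g ≤ Nat.card F ^ (n + 1)) :
    Nat.card F ^ (n - 1) * g ≤ wt σ M := by
  have h1 := le_card_linearIndependent_add σ M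
  have h2 := wt_mul_card_units hn σ M
  refine Nat.le_of_mul_le_mul_right (?_ : _ * Nat.card Fˣ ≤ _) Nat.card_pos
  rw [h2, mul_assoc, mul_comm g]
  gcongr
  omega

theorem wt_single {F : Type} [Field F] [Fintype F] {n : ℕ} (hn : 1 ≤ n) (σ : F ≃+* F) :
    wt σ (Matrix.single (0 : Fin (n + 1)) 0 (1 : F)) =
      Nat.card F ^ (n - 1) * (Nat.card F ^ n - 1) := by
  classical
  have h := wt_mul_card_units hn σ (Matrix.single (0 : Fin (n + 1)) 0 (1 : F))
  have hLI : ∀ x : Fin (n + 1) → F, (x ≠ 0 ∧ LinearIndependent F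
      ![x, Matrix.single (0 : Fin (n + 1)) 0 (1 : F) *ᵥ fun i => σ (x i)]) ↔
      x 0 ≠ 0 ∧ (fun i : Fin n => x i.succ) ≠ 0 := by
    intro x
    have hM : (Matrix.single (0 : Fin (n + 1)) 0 (1 : F) *ᵥ fun i => σ (x i)) =
        Pi.single 0 (σ (x 0)) := by
      rw [Matrix.single_mulVec]
      ext i
      simp [Function.update_apply, Pi.single_apply]
    rw [hM]
    constructor
    · rintro ⟨hx, hl⟩
      rw [LinearIndependent.pair_iff' hx] at hl
      constructor
      · intro h0
        exact hl 0 (by simp [h0])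
      · intro ht
        have h0 : x 0 ≠ 0 := by
          intro h0
          exact hl 0 (by simp [h0])
        apply hl (σ (x 0) / x 0)
        ext i
        refine Fin.cases ?_ (fun j => ?_) i
        · simp [h0]
        · have : x j.succ = 0 := congrFun ht j
          simp [this]
    · rintro ⟨h0, ht⟩
      have hx : x ≠ 0 := fun h' => h0 (by simp [h'])
      refine ⟨hx, (LinearIndependent.pair_iff' hx).2 fun a ha => ?_⟩
      have ha0 : a ≠ 0 := by
        rintro rfl
        have := congrFun ha 0
        simp at this
        exact h0 (by simpa using this.symm)
      apply ht
      ext j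
      have := congrFun ha j.succ
      simpa [ha0] using this
  have hcard : Nat.card {x : Fin (n + 1) → F // x ≠ 0 ∧ LinearIndependent F
      ![x, Matrix.single (0 : Fin (n + 1)) 0 (1 : F) *ᵥ fun i => σ (x i)]} =
      Nat.card Fˣ * (Nat.card F ^ n - 1) := by
    have e1 : Nat.card {y : Fin n → F // y ≠ 0} = Nat.card F ^ n - 1 := by
      simp [Nat.card_eq_fintype_card]
    rw [← e1, ← Nat.card_prod]
    refine Nat.card_congr
      { toFun := fun x => (Units.mk0 (x.1 0) ((hLI _).1 x.2).1, ⟨_, ((hLI _).1 x.2).2⟩)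
        invFun := fun z => ⟨Fin.cons z.1 z.2.1, (hLI _).2 ⟨by simp, by simpa using z.2.2⟩⟩
        left_inv := fun x => Subtype.ext (Fin.cons_self_tail x.1)
        right_inv := fun z => by ext <;> simp }
  rw [hcard, mul_left_comm, mul_comm] at h
  exact Nat.eq_of_mul_eq_mul_left Nat.card_pos h

theorem wt_one_le {F : Type} [Field F] [Fintype F] (σ : F ≃+* F)
    (hσ : σ ≠ RingEquiv.refl F) (hσ2 : σ.trans σ = RingEquiv.refl F) :
    wt σ (1 : Matrix (Fin (2 + 1)) (Fin (2 + 1)) F) ≤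
      Nat.card F * (Nat.card F ^ 2 - Nat.card {c : F // σ c = c}) := by
  have h := wt_mul_card_units (by omega) σ (1 : Matrix (Fin (2 + 1)) (Fin (2 + 1)) F)
  have hq := card_eq_card_fixed_sq σ hσ hσ2
  have hs := two_le_card_fixed σ
  have hp : Nat.card Fˣ + 1 = Nat.card F := by
    rw [Nat.card_units]
    have : 0 < Nat.card F := Nat.card_pos
    omega
  have hG := Set.ncard_add_ncard_compl {x : Fin (2 + 1) → F | x ≠ 0 ∧ LinearIndependent F
      ![x, (1 : Matrix (Fin (2 + 1)) (Fin (2 + 1)) F) *ᵥ fun i => σ (x i)]}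
  have hT : ∀ (c : F) (x : Fin (2 + 1) → F), (∀ i, σ (x i) = x i) →
      c • x ∈ {x : Fin (2 + 1) → F | x ≠ 0 ∧ LinearIndependent F
      ![x, (1 : Matrix (Fin (2 + 1)) (Fin (2 + 1)) F) *ᵥ fun i => σ (x i)]}ᶜ := by
    rintro c x hx ⟨h0, hl⟩
    have hc : c ≠ 0 := by
      rintro rfl
      simp at h0
    rw [LinearIndependent.pair_iff' h0] at hl
    apply hl (σ c / c)
    ext i
    simp [hx]
    field_simp
  let K := {c : F // σ c = c}
  have hle : Nat.card (Option (Fˣ × (K × K ⊕ K ⊕ Unit))) ≤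
      Nat.card ({x : Fin (2 + 1) → F | x ≠ 0 ∧ LinearIndependent F
      ![x, (1 : Matrix (Fin (2 + 1)) (Fin (2 + 1)) F) *ᵥ fun i => σ (x i)]}ᶜ : Set _) := by
    let f : Option (Fˣ × (K × K ⊕ K ⊕ Unit)) →
      ({x : Fin (2 + 1) → F | x ≠ 0 ∧ LinearIndependent F
      ![x, (1 : Matrix (Fin (2 + 1)) (Fin (2 + 1)) F) *ᵥ fun i => σ (x i)]}ᶜ : Set _) := fun z =>
      match z with
      | none => ⟨(0 : F) • 0, hT 0 0 (by simp)⟩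
      | some (c, Sum.inl (a, b)) => ⟨(c : F) • ![1, a.1, b.1], hT _ _ (by
          simp [Fin.forall_fin_succ, a.2, b.2])⟩
      | some (c, Sum.inr (Sum.inl b)) => ⟨(c : F) • ![0, 1, b.1], hT _ _ (by
          simp [Fin.forall_fin_succ, b.2])⟩
      | some (c, Sum.inr (Sum.inr _)) => ⟨(c : F) • ![0, 0, 1], hT _ _ (by
          simp [Fin.forall_fin_succ])⟩
    have hu : ∀ u : Fˣ, (0 : F) ≠ u := fun u => u.ne_zero.symm
    refine Nat.card_le_card_of_injective f ?_
    rintro (_ | ⟨c, (⟨a, b⟩ | b | _)⟩) (_ | ⟨c', (⟨a', b'⟩ | b' | _)⟩) hz <;>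
      have hz := congrArg Subtype.val hz <;>
      have h0 := congrFun hz 0 <;>
      have h1 := congrFun hz 1 <;>
      have h2 := congrFun hz 2 <;>
      simp [f, hu] at h0 h1 h2
    · rfl
    · obtain rfl := Units.ext h0
      simp at h1 h2
      rw [Subtype.ext h1, Subtype.ext h2]
    · obtain rfl := Units.ext h1
      simp at h2
      rw [Subtype.ext h2]
    · obtain rfl := Units.ext h2
      rfl
  rw [Finite.card_option, Nat.card_prod, Nat.card_sum, Nat.card_sum, Nat.card_prod,
    Nat.card_unique (α := Unit)] at hle
  rw [Nat.card_fun, Nat.card_fin] at hG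
  change Nat.card {x : Fin (2 + 1) → F // x ≠ 0 ∧ LinearIndependent F
      ![x, (1 : Matrix (Fin (2 + 1)) (Fin (2 + 1)) F) *ᵥ fun i => σ (x i)]} +
    Nat.card ({x : Fin (2 + 1) → F | x ≠ 0 ∧ LinearIndependent F
      ![x, (1 : Matrix (Fin (2 + 1)) (Fin (2 + 1)) F) *ᵥ fun i => σ (x i)]}ᶜ : Set _) = _ at hG
  refine Nat.le_of_mul_le_mul_right (?_ : _ * Nat.card Fˣ ≤ _) Nat.card_pos
  rw [h, mul_assoc, show 2 - 1 = 1 from rfl, pow_one]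
  gcongr
  change Nat.card Fˣ * (Nat.card {c : F // σ c = c} * Nat.card {c : F // σ c = c} +
    (Nat.card {c : F // σ c = c} + 1)) + 1 ≤ _ at hle
  rw [← hp] at hG hq ⊢
  generalize Nat.card Fˣ = p at *
  generalize Nat.card {c : F // σ c = c} = s at *
  have hsq : s ≤ (p + 1) ^ 2 := by
    rw [hq]
    nlinarith [sq_nonneg (s ^ 2), Nat.le_self_pow (n := 4) (by omega) s]
  zify [hsq] at *
  have e : ((p : ℤ) + 1) ^ (2 + 1) = p * ((p + 1) ^ 2 + (p + 1) + 1) + 1 := by ring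
  rw [e] at hG
  have e2 : (p : ℤ) * (s * s + (s + 1)) = p * ((p + 1) + s + 1) := by
    rw [hq]; ring
  linarith

theorem stmt_10 (F : Type) [Field F] [Fintype F] (n : ℕ) (hn : 2 ≤ n)
    (σ : F ≃+* F) (hσ : σ ≠ RingEquiv.refl F)
    (s : ℕ) (hs : s = Nat.card {a : F // σ a = a}) :
    ((n = 2 ∧ σ.trans σ = RingEquiv.refl F) →
      IsLeast {w : ℕ | ∃ M : Matrix (Fin (n + 1)) (Fin (n + 1)) F, M ≠ 0 ∧ wt σ M = w}
        ((Fintype.card F) ^ 3 - s ^ 3)) ∧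
    ((2 < n ∨ σ.trans σ ≠ RingEquiv.refl F) →
      IsLeast {w : ℕ | ∃ M : Matrix (Fin (n + 1)) (Fin (n + 1)) F, M ≠ 0 ∧ wt σ M = w}
        ((Fintype.card F) ^ (2 * n - 1) - (Fintype.card F) ^ (n - 1))) := by
  have hp : Nat.card F = Nat.card Fˣ + 1 := by
    rw [Nat.card_units]
    have : 0 < Nat.card F := Nat.card_pos
    omega
  have hs2 := hs ▸ two_le_card_fixed σ
  rw [← Nat.card_eq_fintype_card]
  constructor
  · rintro ⟨rfl, hσ2⟩
    have hq := hs ▸ card_eq_card_fixed_sq σ hσ hσ2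
    have hval : Nat.card F ^ 3 - s ^ 3 = Nat.card F ^ (2 - 1) * (Nat.card F ^ 2 - s) := by
      rw [Nat.mul_sub, hq]
      ring_nf
    have hlb : ∀ M : Matrix (Fin (2 + 1)) (Fin (2 + 1)) F, M ≠ 0 →
        Nat.card F ^ 3 - s ^ 3 ≤ wt σ M := by
      intro M hM
      rw [hval]
      apply le_wt_of_eigenvector_bound (by omega)
      have hr := one_le_rank_of_ne_zero hM
      have hr' : M.rank ≤ 3 := by simpa using M.rank_le_card_width
      rw [← hs]
      rw [hp] at hq ⊢
      generalize M.rank = r at *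
      generalize Nat.card Fˣ = p at *
      have hsq : s ≤ (p + 1) ^ 2 := by
        rw [hq, ← pow_mul]
        exact Nat.le_self_pow (by omega) s
      have hps : p ≤ p * s := Nat.le_mul_of_pos_right p (by omega)
      have hps2 : p * s ^ 2 = p * (p + 1) := by rw [hq]
      interval_cases r <;> simp only [Finset.sum_range_succ, Finset.sum_range_zero] <;>
        zify [hsq] at * <;> simp <;> nlinarith
    refine ⟨⟨1, one_ne_zero, le_antisymm ?_ (hlb 1 one_ne_zero)⟩, ?_⟩
    · rw [hval, hs, show 2 - 1 = 1 from rfl, pow_one]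
      exact wt_one_le σ hσ hσ2
    · rintro _ ⟨M, hM, rfl⟩
      exact hlb M hM
  · intro h
    obtain ⟨m, hm, hqm, hm3⟩ := exists_card_eq_card_fixed_pow σ hσ
    rw [← hs] at hqm
    have hval : Nat.card F ^ (2 * n - 1) - Nat.card F ^ (n - 1) =
        Nat.card F ^ (n - 1) * (Nat.card F ^ n - 1) := by
      rw [Nat.mul_sub, ← pow_add, mul_one, show n - 1 + n = 2 * n - 1 by omega]
    rw [hval]
    refine ⟨⟨Matrix.single 0 0 1,
      fun h' => one_ne_zero (α := F) (by simpa using congrFun (congrFun h' 0) 0), wt_single (by omega) σ⟩, ?_⟩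
    rintro _ ⟨M, hM, rfl⟩
    apply le_wt_of_eigenvector_bound (by omega)
    have hr' : M.rank ≤ n + 1 := by simpa using M.rank_le_card_width
    have h2 : s ^ 2 ≤ Nat.card F := hqm ▸ Nat.pow_le_pow_right (by omega) hm
    have h3 : 2 < n ∨ s ^ 3 ≤ Nat.card F :=
      h.imp_right fun h' => hqm ▸ Nat.pow_le_pow_right (by omega) (hm3 h')
    rw [hp] at h2 h3 ⊢
    have := pow_add_mul_geom_sum_le hs2 h2 hn h3 (one_le_rank_of_ne_zero hM) hr'
    rw [← hs]
    have hpos : 1 ≤ (Nat.card Fˣ + 1) ^ n := Nat.one_le_pow _ _ (by omega)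
    calc _ ≤ (Nat.card Fˣ + 1) ^ n + Nat.card Fˣ +
          Nat.card Fˣ * ((Nat.card Fˣ + 1) ^ n - 1) := by gcongr
      _ = _ := by
        zify [hpos]
        ring
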